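/- Let G be a simple connected graph on n ≥ 4 vertices with m edges, largest degree d₁ and second largest degree d₂, and let G″ be a simple connected graph on the same vertex set obtained from G by removing h of its edges, where h ≥ 1 and h < d₂/2. Assume 2m − 2h ≤ (1 + d₁ − 2h) + (n−2)(d₂ − 2h). Then the Kirchhoff index of G″ satisfies K(G″) ≥ n·( 1/(d₁ + 1 − 2h) + 1/(d₂ − 2h) + (n−3)²/(2m + 2h − 1 − d₁ − d₂) ). -/

import Mathlib

open Finset

/-- The eigenvalues of the Laplacian matrix of `G`, arranged in non-increasing order:
`lapEigs G 0 = μ₁ ≥ lapEigs G 1 = μ₂ ≥ …`. -/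
noncomputable def lapEigs {n : ℕ} (G : SimpleGraph (Fin n)) : Fin n → ℝ := by
  letI := Classical.decRel G.Adj
  letI := fun (a b : Fin n) => Classical.dec (a = b)
  exact fun i =>
    ((G.posSemidef_lapMatrix ℝ).isHermitian.eigenvalues ∘
      Tuple.sort (G.posSemidef_lapMatrix ℝ).isHermitian.eigenvalues) i.rev

/-- The degree sequence of `G`, arranged in non-increasing order:
`degSeq G 0 = d₁ ≥ degSeq G 1 = d₂ ≥ …`. -/
noncomputable def degSeq {n : ℕ} (G : SimpleGraph (Fin n)) : Fin n → ℕ := by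
  letI := Classical.decRel G.Adj
  exact fun i => ((fun v => G.degree v) ∘ Tuple.sort (fun v => G.degree v)) i.rev

/-- The Kirchhoff index `K(G) = n ∑_{i=1}^{n-1} 1/μᵢ`. -/
noncomputable def kirchhoffIndex {n : ℕ} (G : SimpleGraph (Fin n)) : ℝ :=
  n * ∑ i ∈ Finset.univ.filter (fun i : Fin n => (i : ℕ) < n - 1), 1 / lapEigs G i

/-- `MajorizedBy y x` (`y ⊴ x`) : every partial sum of `y` is at most the corresponding
partial sum of `x`, with equal total sums. -/
def MajorizedBy {n : ℕ} (y x : Fin n → ℝ) : Prop :=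
  (∀ k : ℕ, k < n →
      ∑ i ∈ Finset.univ.filter (fun i : Fin n => (i : ℕ) < k), y i ≤
        ∑ i ∈ Finset.univ.filter (fun i : Fin n => (i : ℕ) < k), x i) ∧
    ∑ i, y i = ∑ i, x i

theorem inv_ge_tangent {x y : ℝ} (hx : 0 < x) (hy : 0 < y) :
    1 / x - (y - x) / x ^ 2 ≤ 1 / y := by
  have h : 1 / y - (1 / x - (y - x) / x ^ 2) = (y - x) ^ 2 / (x ^ 2 * y) := by
    field_simp
    ring
  have : 0 ≤ (y - x) ^ 2 / (x ^ 2 * y) := by positivity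
  linarith

/-- Among positive vectors of prescribed total whose first two entries are at least `a` and `b`,
the sum of reciprocals is minimised when the remaining entries are all equal. -/
theorem sum_inv_ge_of_two_le {ι : Type*} [Fintype ι] {p q a b c : ℝ} {f : ι → ℝ}
    (hf : ∀ i, 0 < f i) (hc : 0 < c) (hcb : c ≤ b) (hca : c ≤ a) (hap : a ≤ p) (hbq : b ≤ q)
    (hsum : p + q + ∑ i, f i = a + b + Fintype.card ι * c) :
    1 / a + 1 / b + Fintype.card ι / c ≤ 1 / p + 1 / q + ∑ i, 1 / f i := by
  have key {x y : ℝ} (hcx : c ≤ x) (hxy : x ≤ y) : 1 / x - (y - x) / c ^ 2 ≤ 1 / y := by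
    have hx : 0 < x := hc.trans_le hcx
    refine le_trans ?_ (inv_ge_tangent hx (hx.trans_le hxy))
    have : (y - x) / x ^ 2 ≤ (y - x) / c ^ 2 := by
      have := sub_nonneg.2 hxy
      gcongr
    linarith
  have h₁ := key hca hap
  have h₂ := key hcb hbq
  have h₃ : ∑ i, (1 / c - (f i - c) / c ^ 2) ≤ ∑ i, 1 / f i :=
    Finset.sum_le_sum fun i _ => inv_ge_tangent hc (hf i)
  have h₄ : ∑ i, (1 / c - (f i - c) / c ^ 2)
      = Fintype.card ι / c - (∑ i, f i - Fintype.card ι * c) / c ^ 2 := by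
    rw [Finset.sum_sub_distrib, ← Finset.sum_div _ (fun i => f i - c), Finset.sum_sub_distrib]
    simp [div_eq_mul_inv]
  have h₅ : (∑ i, f i - Fintype.card ι * c) / c ^ 2 = -((p - a) / c ^ 2) - (q - b) / c ^ 2 := by
    rw [show ∑ i, f i - Fintype.card ι * c = -(p - a) - (q - b) by linarith]
    ring
  linarith

section Spectral

open Matrix

variable {ι : Type*} [Fintype ι] [DecidableEq ι] {A : Matrix ι ι ℝ} (hA : A.IsHermitian)

theorem sum_sq_eigenvectorBasis_dotProduct (x : ι → ℝ) :
    ∑ i, ((hA.eigenvectorBasis i : ι → ℝ) ⬝ᵥ x) ^ 2 = x ⬝ᵥ x := by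
  have h := hA.eigenvectorBasis.sum_inner_mul_inner (WithLp.toLp 2 x) (WithLp.toLp 2 x)
  simp only [EuclideanSpace.inner_eq_star_dotProduct, star_trivial] at h
  rw [← h]
  exact Finset.sum_congr rfl fun i _ => by rw [sq, dotProduct_comm x]

theorem dotProduct_mulVec_eq_sum_eigenvalues (x : ι → ℝ) :
    x ⬝ᵥ (A *ᵥ x) = ∑ i, hA.eigenvalues i * ((hA.eigenvectorBasis i : ι → ℝ) ⬝ᵥ x) ^ 2 := by
  have h := hA.eigenvectorBasis.sum_inner_mul_inner (WithLp.toLp 2 x) (WithLp.toLp 2 (A *ᵥ x))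
  simp only [EuclideanSpace.inner_eq_star_dotProduct, star_trivial] at h
  rw [dotProduct_comm, ← h]
  refine Finset.sum_congr rfl fun i _ => ?_
  have hi : (A *ᵥ x) ⬝ᵥ (hA.eigenvectorBasis i : ι → ℝ)
      = hA.eigenvalues i * ((hA.eigenvectorBasis i : ι → ℝ) ⬝ᵥ x) := by
    have hT : Aᵀ = A := by rwa [← conjTranspose_eq_transpose_of_trivial]
    rw [dotProduct_comm, dotProduct_mulVec, ← mulVec_transpose, hT, hA.mulVec_eigenvectorBasis,
      smul_dotProduct, smul_eq_mul]
  rw [hi]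
  ring

theorem dotProduct_mulVec_le {M : ℝ} (x : ι → ℝ)
    (hM : ∀ i, (hA.eigenvectorBasis i : ι → ℝ) ⬝ᵥ x ≠ 0 → hA.eigenvalues i ≤ M) :
    x ⬝ᵥ (A *ᵥ x) ≤ M * (x ⬝ᵥ x) := by
  rw [dotProduct_mulVec_eq_sum_eigenvalues hA, ← sum_sq_eigenvectorBasis_dotProduct hA,
    Finset.mul_sum]
  refine Finset.sum_le_sum fun i _ => ?_
  by_cases h : (hA.eigenvectorBasis i : ι → ℝ) ⬝ᵥ x = 0
  · simp [h]
  · exact mul_le_mul_of_nonneg_right (hM i h) (sq_nonneg _)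

end Spectral

namespace SimpleGraph

open Matrix

variable {V : Type*} [Fintype V] (G : SimpleGraph V) [DecidableRel G.Adj]

theorem degree_le_degree_add_ncard_sdiff {H : SimpleGraph V} [DecidableRel H.Adj]
    (v : V) : G.degree v ≤ H.degree v + (G.edgeSet \ H.edgeSet).ncard := by
  classical
  have h₁ : (G.incidenceFinset v) ⊆ H.incidenceFinset v ∪ (G.edgeSet \ H.edgeSet).toFinset := by
    intro e he
    simp only [Finset.mem_union, mem_incidenceFinset, Set.mem_toFinset, Set.mem_sdiff] at he ⊢
    by_cases h : e ∈ H.edgeSet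
    · exact Or.inl ⟨h, he.2⟩
    · exact Or.inr ⟨he.1, h⟩
  have h₂ := (Finset.card_le_card h₁).trans (Finset.card_union_le _ _)
  rwa [card_incidenceFinset_eq_degree, card_incidenceFinset_eq_degree,
    ← Set.ncard_eq_toFinset_card'] at h₂

variable [DecidableEq V]

theorem trace_lapMatrix_eq : (G.lapMatrix ℝ).trace = 2 * (G.edgeSet.ncard : ℝ) := by
  have h := congrArg (Nat.cast : ℕ → ℝ) G.sum_degrees_eq_twice_card_edges
  rw [Set.ncard_eq_toFinset_card', lapMatrix, trace_sub, trace_adjMatrix]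
  push_cast at h
  simpa [degMatrix, trace_diagonal, edgeFinset] using h

theorem lapMatrix_apply_self (v : V) : G.lapMatrix ℝ v v = G.degree v := by
  simp [lapMatrix, degMatrix]

theorem lapMatrix_apply_abs_le_one {u v : V} (h : u ≠ v) : |G.lapMatrix ℝ u v| ≤ 1 := by
  by_cases hadj : G.Adj u v <;> simp [lapMatrix, degMatrix, h, adjMatrix_apply, hadj]

theorem le_dotProduct_lapMatrix_pair {u v : V} (huv : u ≠ v) {D : ℝ} (hu : D ≤ G.degree u)
    (hv : D ≤ G.degree v) (s t : ℝ) :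
    (D - 1) * ((Pi.single u s + Pi.single v t : V → ℝ) ⬝ᵥ (Pi.single u s + Pi.single v t))
      ≤ (Pi.single u s + Pi.single v t : V → ℝ) ⬝ᵥ
        (G.lapMatrix ℝ *ᵥ (Pi.single u s + Pi.single v t)) := by
  have hsymm : G.lapMatrix ℝ v u = G.lapMatrix ℝ u v := (G.isSymm_lapMatrix (R := ℝ)).apply u v
  have h₁ := abs_le.1 (G.lapMatrix_apply_abs_le_one huv)
  simp only [mulVec_add, add_dotProduct, dotProduct_add, single_dotProduct, mulVec_single,
    Pi.smul_apply, Matrix.col_apply, lapMatrix_apply_self, hsymm, MulOpposite.smul_eq_mul_unop,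
    MulOpposite.unop_op, Pi.single_eq_same, Pi.single_eq_of_ne huv, Pi.single_eq_of_ne huv.symm]
  nlinarith [mul_nonneg (sub_nonneg.2 hu) (sq_nonneg s), mul_nonneg (sub_nonneg.2 hv) (sq_nonneg t),
    mul_nonneg (by linarith : 0 ≤ 1 + G.lapMatrix ℝ u v) (sq_nonneg (s + t)),
    mul_nonneg (by linarith : 0 ≤ 1 - G.lapMatrix ℝ u v) (sq_nonneg (s - t))]

theorem eigenvectorBasis_const_of_eigenvalue_eq_zero {G : SimpleGraph V} [DecidableRel G.Adj]
    (hG : G.Connected) (hL : (G.lapMatrix ℝ).IsHermitian) {i : V} (hi : hL.eigenvalues i = 0)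
    (u v : V) : hL.eigenvectorBasis i u = hL.eigenvectorBasis i v := by
  have h := hL.mulVec_eigenvectorBasis i
  rw [hi, zero_smul, lapMatrix_mulVec_eq_zero_iff_forall_reachable] at h
  exact h u v (hG.preconnected u v)

theorem eigenvalue_zero_unique {G : SimpleGraph V} [DecidableRel G.Adj]
    (hG : G.Connected) (hL : (G.lapMatrix ℝ).IsHermitian) {i j : V} (hi : hL.eigenvalues i = 0)
    (hj : hL.eigenvalues j = 0) : i = j := by
  by_contra hij
  have : Nonempty V := hG.nonempty
  let v : V := Classical.arbitrary V
  have hself (k : V) (hk : hL.eigenvalues k = 0) : hL.eigenvectorBasis k v ≠ 0 := by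
    intro h0
    apply hL.eigenvectorBasis.orthonormal.ne_zero k
    ext u
    rw [eigenvectorBasis_const_of_eigenvalue_eq_zero hG hL hk u v, h0]
    rfl
  have horth : inner ℝ (hL.eigenvectorBasis i) (hL.eigenvectorBasis j) = 0 :=
    hL.eigenvectorBasis.orthonormal.2 hij
  rw [EuclideanSpace.inner_eq_star_dotProduct, star_trivial, dotProduct] at horth
  simp only [eigenvectorBasis_const_of_eigenvalue_eq_zero hG hL hi _ v,
    eigenvectorBasis_const_of_eigenvalue_eq_zero hG hL hj _ v, Finset.sum_const, nsmul_eq_mul,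
    mul_eq_zero, Nat.cast_eq_zero, Finset.card_univ, Fintype.card_ne_zero, false_or] at horth
  exact horth.elim (hself j hj) (hself i hi)

theorem exists_eigenvalue_eq_zero [Nonempty V] (hL : (G.lapMatrix ℝ).IsHermitian) :
    ∃ i, hL.eigenvalues i = 0 := by
  have h := hL.det_eq_prod_eigenvalues
  rw [det_lapMatrix_eq_zero] at h
  obtain ⟨i, -, hi⟩ := Finset.prod_eq_zero_iff.1 h.symm
  exact ⟨i, by simpa using hi⟩

end SimpleGraph

section Sorted

open Matrix

variable {n : ℕ}

theorem lapEigs_eq_comp_perm (G : SimpleGraph (Fin n)) [DecidableRel G.Adj] :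
    ∃ σ : Equiv.Perm (Fin n), ∀ i,
      lapEigs G i = (G.posSemidef_lapMatrix ℝ).isHermitian.eigenvalues (σ i) := by
  refine ⟨Fin.revPerm.trans (Tuple.sort (G.posSemidef_lapMatrix ℝ).isHermitian.eigenvalues),
    fun i => ?_⟩
  unfold lapEigs
  simp only [Function.comp_apply, Equiv.trans_apply]
  congr!

theorem lapEigs_antitone (G : SimpleGraph (Fin n)) : Antitone (lapEigs G) := by
  intro i j hij
  unfold lapEigs
  exact Tuple.monotone_sort _ (Fin.rev_le_rev.2 hij)

theorem degSeq_eq_comp_perm (G : SimpleGraph (Fin n)) [DecidableRel G.Adj] :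
    ∃ σ : Equiv.Perm (Fin n), ∀ i, degSeq G i = G.degree (σ i) := by
  obtain rfl : ‹DecidableRel G.Adj› = Classical.decRel G.Adj := Subsingleton.elim _ _
  let _ := Classical.decRel G.Adj
  exact ⟨Fin.revPerm.trans (Tuple.sort fun v => G.degree v), fun _ => rfl⟩

theorem degSeq_antitone (G : SimpleGraph (Fin n)) : Antitone (degSeq G) := by
  intro i j hij
  unfold degSeq
  exact Tuple.monotone_sort (f := _) (Fin.rev_le_rev.2 hij)

theorem sum_lapEigs (G : SimpleGraph (Fin n)) :
    ∑ i, lapEigs G i = 2 * (G.edgeSet.ncard : ℝ) := by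
  classical
  obtain ⟨σ, hσ⟩ := lapEigs_eq_comp_perm G
  rw [← G.trace_lapMatrix_eq, (G.posSemidef_lapMatrix ℝ).isHermitian.trace_eq_sum_eigenvalues]
  simp only [hσ]
  exact Equiv.sum_comp σ (G.posSemidef_lapMatrix ℝ).isHermitian.eigenvalues

theorem lapEigs_nonneg (G : SimpleGraph (Fin n)) (i : Fin n) : 0 ≤ lapEigs G i := by
  classical
  obtain ⟨σ, hσ⟩ := lapEigs_eq_comp_perm G
  rw [hσ]
  exact (G.posSemidef_lapMatrix ℝ).eigenvalues_nonneg _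

theorem lapEigs_last {k : ℕ} (G : SimpleGraph (Fin (k + 1))) : lapEigs G (Fin.last k) = 0 := by
  classical
  obtain ⟨σ, hσ⟩ := lapEigs_eq_comp_perm G
  obtain ⟨i, hi⟩ := G.exists_eigenvalue_eq_zero (G.posSemidef_lapMatrix ℝ).isHermitian
  refine le_antisymm ?_ (lapEigs_nonneg G _)
  rw [← hi, ← σ.apply_symm_apply i, ← hσ]
  exact lapEigs_antitone G (Fin.le_last _)

theorem lapEigs_pos {k : ℕ} {G : SimpleGraph (Fin (k + 1))} (hG : G.Connected) {i : Fin (k + 1)}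
    (hi : i ≠ Fin.last k) : 0 < lapEigs G i := by
  classical
  refine (lapEigs_nonneg G i).lt_of_ne' fun h => hi ?_
  have hlast := lapEigs_last G
  obtain ⟨σ, hσ⟩ := lapEigs_eq_comp_perm G
  rw [hσ] at h hlast
  exact σ.injective (SimpleGraph.eigenvalue_zero_unique hG _ h hlast)

theorem degree_le_lapEigs_zero (G : SimpleGraph (Fin n)) [DecidableRel G.Adj] (hn : 0 < n)
    (v : Fin n) : (G.degree v : ℝ) ≤ lapEigs G ⟨0, hn⟩ := by
  obtain ⟨σ, hσ⟩ := lapEigs_eq_comp_perm G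
  have h := dotProduct_mulVec_le (G.posSemidef_lapMatrix ℝ).isHermitian
    (M := lapEigs G ⟨0, hn⟩) (Pi.single v 1) fun i _ => by
      rw [← σ.apply_symm_apply i, ← hσ]
      exact lapEigs_antitone G (Fin.mk_le_of_le_val (Nat.zero_le _))
  simpa [SimpleGraph.lapMatrix_apply_self] using h

theorem sub_one_le_lapEigs_one (G : SimpleGraph (Fin n)) [DecidableRel G.Adj] (hn : 1 < n)
    {u v : Fin n} (huv : u ≠ v) {D : ℝ} (hu : D ≤ G.degree u) (hv : D ≤ G.degree v) :
    D - 1 ≤ lapEigs G ⟨1, hn⟩ := by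
  obtain ⟨σ, hσ⟩ := lapEigs_eq_comp_perm G
  set hL := (G.posSemidef_lapMatrix ℝ).isHermitian
  set w : Fin n → ℝ := (hL.eigenvectorBasis (σ ⟨0, by omega⟩)).ofLp
  obtain ⟨s, t, hst, horth⟩ : ∃ s t : ℝ, 0 < s ^ 2 + t ^ 2 ∧ w u * s + w v * t = 0 := by
    by_cases hw : w v = 0
    · exact ⟨0, 1, by norm_num, by simp [hw]⟩
    · exact ⟨w v, -w u, by positivity, by ring⟩
  have h := dotProduct_mulVec_le hL (M := lapEigs G ⟨1, hn⟩)
    (Pi.single u s + Pi.single v t) fun i hi => by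
      have hne : i ≠ σ ⟨0, by omega⟩ := by
        rintro rfl
        exact hi (by simpa [dotProduct_add] using horth)
      rw [← σ.apply_symm_apply i, ← hσ]
      refine lapEigs_antitone G (Fin.mk_le_of_le_val (Nat.one_le_iff_ne_zero.2 fun h0 => hne ?_))
      rw [← σ.apply_symm_apply i]
      exact congrArg σ (Fin.ext h0)
  have h' := (G.le_dotProduct_lapMatrix_pair huv hu hv s t).trans h
  have hnorm : (Pi.single u s + Pi.single v t : Fin n → ℝ) ⬝ᵥ (Pi.single u s + Pi.single v t)
      = s ^ 2 + t ^ 2 := by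
    simp only [add_dotProduct, single_dotProduct, Pi.add_apply, Pi.single_eq_same,
      Pi.single_eq_of_ne huv, Pi.single_eq_of_ne huv.symm]
    ring
  rw [hnorm] at h'
  exact le_of_mul_le_mul_right h' hst

theorem kirchhoffIndex_eq {k : ℕ} (G : SimpleGraph (Fin (k + 1))) :
    kirchhoffIndex G = ((k + 1 : ℕ) : ℝ) * ∑ i : Fin k, 1 / lapEigs G i.castSucc := by
  unfold kirchhoffIndex
  congr 1
  rw [Finset.sum_filter, Fin.sum_univ_castSucc]
  simp

end Sorted

/-- For a simple connected graph `G` on `n ≥ 4` vertices with `m` edges,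
largest degree `d₁` and second largest degree `d₂`, and a simple connected graph `G''`
obtained from `G` by removing `h` of its edges with `h ≥ 1` and `h < d₂/2`, if
`2m − 2h ≤ (1 + d₁ − 2h) + (n−2)(d₂ − 2h)` then
`K(G'') ≥ n (1/(d₁+1−2h) + 1/(d₂−2h) + (n−3)²/(2m+2h−1−d₁−d₂))`. -/
theorem kirchhoff_lower_bound_remove_links {n m h d₁ d₂ : ℕ}
    (hn : 4 ≤ n)
    (G G'' : SimpleGraph (Fin n))
    (hconn : G.Connected)
    (hm : G.edgeSet.ncard = m)
    (hd₁ : d₁ = degSeq G ⟨0, by omega⟩)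
    (hd₂ : d₂ = degSeq G ⟨1, by omega⟩)
    (hsub : G'' ≤ G)
    (hconn'' : G''.Connected)
    (hm'' : G''.edgeSet.ncard = m - h)
    (hh₁ : 1 ≤ h)
    (hh₂ : (h : ℝ) < (d₂ : ℝ) / 2)
    (hass : 2 * (m : ℝ) - 2 * (h : ℝ) ≤
        (1 + (d₁ : ℝ) - 2 * (h : ℝ)) + ((n : ℝ) - 2) * ((d₂ : ℝ) - 2 * (h : ℝ))) :
    (n : ℝ) * (1 / ((d₁ : ℝ) + 1 - 2 * (h : ℝ)) + 1 / ((d₂ : ℝ) - 2 * (h : ℝ)) +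
        ((n : ℝ) - 3) ^ 2 / (2 * (m : ℝ) + 2 * (h : ℝ) - 1 - (d₁ : ℝ) - (d₂ : ℝ)))
      ≤ kirchhoffIndex G'' := by
  classical
  obtain ⟨k, rfl⟩ : ∃ k, n = k + 1 + 1 + 1 + 1 := ⟨n - 4, by omega⟩
  obtain ⟨τ, hτ⟩ := degSeq_eq_comp_perm G
  set u := τ ⟨0, by omega⟩
  set v := τ ⟨1, by omega⟩
  have huv : u ≠ v := τ.injective.ne (by simp)
  have hdu : d₁ = G.degree u := hd₁.trans (hτ _)
  have hdv : d₂ = G.degree v := hd₂.trans (hτ _)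
  have hd : d₂ ≤ d₁ := by
    rw [hd₁, hd₂]
    exact degSeq_antitone G (Fin.mk_le_of_le_val (Nat.zero_le _))
  have hd2m : d₁ + d₂ ≤ 2 * m := by
    have hs := G.sum_degrees_eq_twice_card_edges
    rw [← hm, Set.ncard_eq_toFinset_card', ← SimpleGraph.edgeFinset, ← hs, hdu, hdv,
      ← Finset.sum_pair (f := fun w => G.degree w) huv]
    exact Finset.sum_le_sum_of_subset (Finset.subset_univ _)
  have hh : 2 * h < d₂ := by
    have : (2 * h : ℝ) < d₂ := by linarith
    exact_mod_cast this
  have hhm : h ≤ m := by omega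
  have hremoved : (G.edgeSet \ G''.edgeSet).ncard = h := by
    rw [Set.ncard_sdiff (SimpleGraph.edgeSet_mono hsub), hm, hm'']
    omega
  have hu := G.degree_le_degree_add_ncard_sdiff (H := G'') u
  have hv := G.degree_le_degree_add_ncard_sdiff (H := G'') v
  rw [hremoved, ← hdu] at hu
  rw [hremoved, ← hdv] at hv
  have hu' : (d₁ : ℝ) ≤ G''.degree u + h := by exact_mod_cast hu
  have hv' : (d₂ : ℝ) ≤ G''.degree v + h := by exact_mod_cast hv
  have hdR : (d₂ : ℝ) ≤ d₁ := by exact_mod_cast hd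
  have hh₁R : (1 : ℝ) ≤ h := by exact_mod_cast hh₁
  have hd2mR : (d₁ + d₂ : ℝ) ≤ 2 * m := by exact_mod_cast hd2m
  have hμ₁ := degree_le_lapEigs_zero G'' (by omega) u
  have hμ₂ := sub_one_le_lapEigs_one G'' (by omega) huv (D := d₂ - h) (by linarith) (by linarith)
  have htotal := sum_lapEigs G''
  rw [hm'', Nat.cast_sub hhm, Fin.sum_univ_castSucc, lapEigs_last, Fin.sum_univ_succ,
    Fin.sum_univ_succ] at htotal
  rw [kirchhoffIndex_eq, Fin.sum_univ_succ, Fin.sum_univ_succ]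
  refine mul_le_mul_of_nonneg_left ?_ (Nat.cast_nonneg _)
  push_cast at hass ⊢
  set S : ℝ := 2 * m + 2 * h - 1 - d₁ - d₂
  have hS : 0 < S := by linarith
  have hk : (0 : ℝ) < k + 1 := by positivity
  have hcb : S / (k + 1) ≤ d₂ - 2 * h := by
    rw [div_le_iff₀ hk]
    linarith
  have hmain := sum_inv_ge_of_two_le
    (p := lapEigs G'' ⟨0, by omega⟩) (q := lapEigs G'' ⟨1, by omega⟩)
    (a := d₁ + 1 - 2 * h) (b := d₂ - 2 * h) (c := S / (k + 1))
    (f := fun i : Fin (k + 1) => lapEigs G'' i.succ.succ.castSucc)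
    (fun i => lapEigs_pos hconn'' (Fin.castSucc_ne_last _)) (by positivity) hcb
    (by linarith) (by linarith) (by linarith) (by
      rw [Fintype.card_fin, Nat.cast_succ, mul_div_cancel₀ _ hk.ne']
      simp only [S]
      have : lapEigs G'' (Fin.castSucc 0) + (lapEigs G'' (Fin.castSucc (Fin.succ 0))
        + ∑ i : Fin (k + 1), lapEigs G'' i.succ.succ.castSucc) + 0 = 2 * (m - h) := htotal
      change lapEigs G'' (Fin.castSucc 0) + lapEigs G'' (Fin.castSucc (Fin.succ 0)) + _ = _
      linarith)
  rw [Fintype.card_fin, Nat.cast_succ] at hmain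
  have hlast : ((k : ℝ) + 1 + 1 + 1 + 1 - 3) ^ 2 / S = (k + 1) / (S / (k + 1)) := by
    field_simp
    ring
  rw [hlast, ← add_assoc]
  exact hmain
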